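/- arXiv:2204.03603 — 3 statements merged into one kernel-verified Lean document; each statement's English description precedes it below -/
import Mathlib

section
/- Suppose the Runge-Kutta scheme has weak stage order at least q for some integer q ≥ 2. Then there exists a unique monic polynomial P ∈ ℝ[x] of minimal degree such that P(A)·τ^(k) = 0 for k = 2,...,q. Moreover deg P ≤ dim K_q, and the product P(x)·Q(x) divides the characteristic polynomial det(xI − A) of A, where Q ∈ ℝ[x] is the unique monic polynomial of minimal degree with bᵀ Q(A) = 0. -/
open Matrix Polynomial

noncomputable section

/-- The all-ones vector `e = (1,...,1)ᵀ ∈ ℝˢ`. -/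
def ones (s : ℕ) : Fin s → ℝ := fun _ => 1

/-- The abscissa vector `c := A·e`. -/
def cvec {s : ℕ} (A : Matrix (Fin s) (Fin s) ℝ) : Fin s → ℝ := A.mulVec (ones s)

/-- The stage order residual `τ^(k) := A·c^{k−1} − (1/k)·c^k` (componentwise powers). -/
def tauvec {s : ℕ} (A : Matrix (Fin s) (Fin s) ℝ) (k : ℕ) : Fin s → ℝ :=
  A.mulVec (fun i => cvec A i ^ (k - 1)) - (1 / (k : ℝ)) • fun i => cvec A i ^ k

/-- `K_m := span{ Aʲ τ^(k) : 0 ≤ j ≤ s−1, 1 ≤ k ≤ m }`. -/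
def Kspace {s : ℕ} (A : Matrix (Fin s) (Fin s) ℝ) (m : ℕ) : Submodule ℝ (Fin s → ℝ) :=
  Submodule.span ℝ {v | ∃ j k : ℕ, j < s ∧ 1 ≤ k ∧ k ≤ m ∧ v = (A ^ j).mulVec (tauvec A k)}

/-- `Y := span{ (Aᵀ)ʲ b : 0 ≤ j ≤ s−1 }`. -/
def Yspace {s : ℕ} (A : Matrix (Fin s) (Fin s) ℝ) (b : Fin s → ℝ) : Submodule ℝ (Fin s → ℝ) :=
  Submodule.span ℝ {v | ∃ j : ℕ, j < s ∧ v = (A.transpose ^ j).mulVec b}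

/-- Weak stage order at least `q`: `bᵀ Aʲ τ^(k) = 0` for `0 ≤ j ≤ s−1`, `1 ≤ k ≤ q`. -/
def WSO {s : ℕ} (A : Matrix (Fin s) (Fin s) ℝ) (b : Fin s → ℝ) (q : ℕ) : Prop :=
  ∀ j k : ℕ, j < s → 1 ≤ k → k ≤ q → b ⬝ᵥ (A ^ j).mulVec (tauvec A k) = 0

/-- `n_c`: the number of distinct abscissas, i.e. distinct entries of `c`. -/
def numAbscissas {s : ℕ} (A : Matrix (Fin s) (Fin s) ℝ) : ℕ :=
  (Finset.univ.image (cvec A)).card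


/-- The scheme is stiffly accurate: the last row of `A` equals `bᵀ`. -/
def StifflyAccurate {s : ℕ} (hs : 0 < s) (A : Matrix (Fin s) (Fin s) ℝ) (b : Fin s → ℝ) : Prop :=
  ∀ j, A ⟨s - 1, Nat.sub_lt hs Nat.one_pos⟩ j = b j

/-- A DIRK scheme: `A` is lower triangular. -/
def LowerTriangular {s : ℕ} (A : Matrix (Fin s) (Fin s) ℝ) : Prop :=
  ∀ i j : Fin s, i < j → A i j = 0

/-- A GEDIRK: `c` has a zero entry, and `a_{ℓℓ} = 0` where `ℓ` is the smallest index with `c_ℓ = 0`. -/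
def GEDIRK {s : ℕ} (A : Matrix (Fin s) (Fin s) ℝ) : Prop :=
  ∃ l : Fin s, cvec A l = 0 ∧ (∀ j : Fin s, j < l → cvec A j ≠ 0) ∧ A l l = 0

/-- `QProp A b Q`: `Q` is monic, `bᵀ Q(A) = 0`, and `Q` has minimal degree among such monic
polynomials. -/
def QProp {s : ℕ} (A : Matrix (Fin s) (Fin s) ℝ) (b : Fin s → ℝ) (Q : Polynomial ℝ) : Prop :=
  Q.Monic ∧ b ᵥ* (aeval A Q) = 0 ∧
    ∀ R : Polynomial ℝ, R.Monic → b ᵥ* (aeval A R) = 0 → Q.degree ≤ R.degree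

/-- `PProp A q P`: `P` is monic, `P(A)·τ^(k) = 0` for `k = 2,…,q`, and `P` has minimal degree
among such monic polynomials. -/
def PProp {s : ℕ} (A : Matrix (Fin s) (Fin s) ℝ) (q : ℕ) (P : Polynomial ℝ) : Prop :=
  P.Monic ∧ (∀ k : ℕ, 2 ≤ k → k ≤ q → (aeval A P).mulVec (tauvec A k) = 0) ∧
    ∀ R : Polynomial ℝ, R.Monic →
      (∀ k : ℕ, 2 ≤ k → k ≤ q → (aeval A R).mulVec (tauvec A k) = 0) → P.degree ≤ R.degree

theorem LinearMap.comp_aeval_of_comp_eq {V W : Type*} [AddCommGroup V] [Module ℝ V]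
    [AddCommGroup W] [Module ℝ W] {f : V →ₗ[ℝ] V} {g : W →ₗ[ℝ] W} {h : V →ₗ[ℝ] W}
    (hfg : ∀ v, h (f v) = g (h v)) (p : ℝ[X]) (v : V) :
    h (aeval f p v) = aeval g p (h v) := by
  induction p using Polynomial.induction_on' generalizing v with
  | add p r hp hr => simp [hp, hr]
  | monomial n a =>
    have hpow : ∀ n : ℕ, h ((f ^ n) v) = (g ^ n) (h v) := by
      intro n
      induction n with
      | zero => simp
      | succ n ih => simp only [pow_succ', Module.End.mul_apply, hfg, ih]
    simp [aeval_monomial, hpow]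

theorem LinearMap.charpoly_eq_charpoly_restrict_mul_charpoly_mapQ {V : Type*} [AddCommGroup V]
    [Module ℝ V] [FiniteDimensional ℝ V] (W : Submodule ℝ V) (f : V →ₗ[ℝ] V)
    (hf : W ≤ W.comap f) :
    f.charpoly = LinearMap.charpoly (f.restrict hf) * (W.mapQ W f hf).charpoly := by
  refine Polynomial.funext fun t => ?_
  have ht : W ≤ W.comap (algebraMap ℝ (Module.End ℝ V) t - f) := fun w hw =>
    W.sub_mem (W.smul_mem t hw) (hf hw)
  rw [eval_mul, LinearMap.eval_charpoly, LinearMap.eval_charpoly, LinearMap.eval_charpoly,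
    LinearMap.det_eq_det_mul_det W _ ht]
  congr 2
  ext v
  simp

theorem Ideal.dvd_of_monic_of_degree_le {I : Ideal ℝ[X]} {P : ℝ[X]} (hP : P.Monic) (hPI : P ∈ I)
    (hmin : ∀ R : ℝ[X], R.Monic → R ∈ I → P.degree ≤ R.degree) {R : ℝ[X]} (hR : R ∈ I) :
    P ∣ R := by
  rw [← modByMonic_eq_zero_iff_dvd hP]
  by_contra hne
  have hmem : R %ₘ P ∈ I := by
    rw [modByMonic_eq_sub_mul_div]
    exact I.sub_mem hR (I.mul_mem_right _ hPI)
  have hle := hmin _ (monic_mul_leadingCoeff_inv hne) (I.mul_mem_right _ hmem)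
  rw [degree_mul_leadingCoeff_inv _ hne] at hle
  exact absurd (degree_modByMonic_lt R hP) (not_lt.mpr hle)

theorem Ideal.existsUnique_monic_degree_le {I : Ideal ℝ[X]} (hI : ∃ R : ℝ[X], R.Monic ∧ R ∈ I) :
    ∃! P : ℝ[X], P.Monic ∧ P ∈ I ∧ ∀ R : ℝ[X], R.Monic → R ∈ I → P.degree ≤ R.degree := by
  obtain ⟨P, ⟨hP, hPI⟩, hmin⟩ :=
    WellFounded.has_min (degree_lt_wf (R := ℝ)) {R | R.Monic ∧ R ∈ I} hI
  have hmin' : ∀ R : ℝ[X], R.Monic → R ∈ I → P.degree ≤ R.degree := fun R hR hRI =>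
    not_lt.mp (hmin R ⟨hR, hRI⟩)
  refine ⟨P, ⟨hP, hPI, hmin'⟩, fun R ⟨hR, hRI, hRmin⟩ => ?_⟩
  exact eq_of_monic_of_associated hR hP (associated_of_dvd_dvd
    (dvd_of_monic_of_degree_le hR hRI hRmin hPI) (dvd_of_monic_of_degree_le hP hPI hmin' hRI))

/-- The polynomials `p` with `p(A)·τ^(k) = 0` for `k = 2,…,q`. -/
def residualAnnihilator {s : ℕ} (A : Matrix (Fin s) (Fin s) ℝ) (q : ℕ) : Ideal ℝ[X] where
  carrier := {p | ∀ k : ℕ, 2 ≤ k → k ≤ q → (aeval A p).mulVec (tauvec A k) = 0}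
  zero_mem' := by simp
  add_mem' hp hr k h2 hk := by rw [map_add, add_mulVec, hp k h2 hk, hr k h2 hk, add_zero]
  smul_mem' r p hp k h2 hk := by
    rw [smul_eq_mul, map_mul, ← mulVec_mulVec, hp k h2 hk, mulVec_zero]

/-- The polynomials `p` with `bᵀ p(A) = 0`. -/
def weightAnnihilator {s : ℕ} (A : Matrix (Fin s) (Fin s) ℝ) (b : Fin s → ℝ) : Ideal ℝ[X] where
  carrier := {p | b ᵥ* (aeval A p) = 0}
  zero_mem' := by simp
  add_mem' {p r} hp hr := by
    rw [Set.mem_ofPred_eq] at *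
    rw [map_add, vecMul_add, hp, hr, add_zero]
  smul_mem' r p hp := by
    rw [Set.mem_ofPred_eq] at *
    rw [smul_eq_mul, mul_comm, map_mul, ← vecMul_vecMul, hp, zero_vecMul]

theorem pow_mulVec_mem_span_pow_mulVec {s : ℕ} (A : Matrix (Fin s) (Fin s) ℝ) (v : Fin s → ℝ)
    (n : ℕ) :
    (A ^ n).mulVec v ∈ Submodule.span ℝ {w | ∃ j : ℕ, j < s ∧ w = (A ^ j).mulVec v} := by
  rcases Nat.eq_zero_or_pos s with rfl | hs
  · rw [Subsingleton.elim ((A ^ n).mulVec v) 0]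
    exact Submodule.zero_mem _
  · have : Nonempty (Fin s) := ⟨⟨0, hs⟩⟩
    have hdeg : (X ^ n %ₘ A.charpoly).natDegree < s := by
      refine (natDegree_modByMonic_lt _ A.charpoly_monic fun h => ?_).trans_eq (by simp)
      have := A.charpoly_natDegree_eq_dim
      rw [h] at this
      simp at this
      omega
    rw [A.pow_eq_aeval_mod_charpoly n, aeval_eq_sum_range' hdeg, sum_mulVec]
    refine Submodule.sum_mem _ fun j hj => ?_
    rw [smul_mulVec]
    exact Submodule.smul_mem _ _ (Submodule.subset_span ⟨j, Finset.mem_range.mp hj, rfl⟩)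

theorem Kspace_le_comap_mulVecLin {s : ℕ} (A : Matrix (Fin s) (Fin s) ℝ) (m : ℕ) :
    Kspace A m ≤ (Kspace A m).comap A.mulVecLin := by
  refine Submodule.span_le.mpr ?_
  rintro _ ⟨j, k, hj, h1, hk, rfl⟩
  change A.mulVec ((A ^ j).mulVec (tauvec A k)) ∈ Kspace A m
  rw [mulVec_mulVec, ← pow_succ']
  refine Submodule.span_mono ?_ (pow_mulVec_mem_span_pow_mulVec A (tauvec A k) (j + 1))
  rintro _ ⟨i, hi, rfl⟩
  exact ⟨i, k, hi, h1, hk, rfl⟩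

theorem tauvec_mem_Kspace {s : ℕ} (A : Matrix (Fin s) (Fin s) ℝ) {k m : ℕ} (h1 : 1 ≤ k)
    (hk : k ≤ m) : tauvec A k ∈ Kspace A m := by
  rcases Nat.eq_zero_or_pos s with rfl | hs
  · rw [Subsingleton.elim (tauvec A k) 0]
    exact Submodule.zero_mem _
  · exact Submodule.subset_span ⟨0, k, hs, h1, hk, by simp⟩

theorem mulVecLin_aeval {s : ℕ} (A : Matrix (Fin s) (Fin s) ℝ) (p : ℝ[X]) (v : Fin s → ℝ) :
    aeval A.mulVecLin p v = (aeval A p).mulVec v := by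
  have h := aeval_algHom_apply (toLinAlgEquiv' (R := ℝ) (n := Fin s)).toAlgHom A p
  exact LinearMap.congr_fun h v

theorem charpoly_restrict_mem_residualAnnihilator {s : ℕ} (A : Matrix (Fin s) (Fin s) ℝ) (q : ℕ) :
    LinearMap.charpoly (A.mulVecLin.restrict (Kspace_le_comap_mulVecLin A q)) ∈
      residualAnnihilator A q := by
  intro k h2 hk
  have h := LinearMap.comp_aeval_of_comp_eq
    (f := A.mulVecLin.restrict (Kspace_le_comap_mulVecLin A q)) (g := A.mulVecLin)
    (h := (Kspace A q).subtype) (fun _ => rfl)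
    (LinearMap.charpoly (A.mulVecLin.restrict (Kspace_le_comap_mulVecLin A q)))
    ⟨tauvec A k, tauvec_mem_Kspace A (one_le_two.trans h2) hk⟩
  rw [LinearMap.aeval_self_charpoly, mulVecLin_aeval] at h
  exact h.symm

theorem charpoly_mapQ_mem_weightAnnihilator {s : ℕ} (A : Matrix (Fin s) (Fin s) ℝ)
    (b : Fin s → ℝ) (q : ℕ) (hwso : WSO A b q) :
    ((Kspace A q).mapQ _ A.mulVecLin (Kspace_le_comap_mulVecLin A q)).charpoly ∈
      weightAnnihilator A b := by
  have hker : ∀ w ∈ Kspace A q, b ⬝ᵥ w = 0 := by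
    intro w hw
    induction hw using Submodule.span_induction with
    | mem w hw =>
      obtain ⟨j, k, hj, h1, hk, rfl⟩ := hw
      exact hwso j k hj h1 hk
    | zero => simp
    | add u v _ _ hu hv => rw [dotProduct_add, hu, hv, add_zero]
    | smul a v _ hv => rw [dotProduct_smul, hv, smul_zero]
  refine dotProduct_eq_zero _ fun v => ?_
  rw [← dotProduct_mulVec]
  refine hker _ ?_
  have h := LinearMap.comp_aeval_of_comp_eq (f := A.mulVecLin)
    (g := (Kspace A q).mapQ _ A.mulVecLin (Kspace_le_comap_mulVecLin A q))
    (h := (Kspace A q).mkQ) (fun _ => rfl)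
    ((Kspace A q).mapQ _ A.mulVecLin (Kspace_le_comap_mulVecLin A q)).charpoly v
  rw [LinearMap.aeval_self_charpoly, mulVecLin_aeval] at h
  exact (Submodule.Quotient.mk_eq_zero _).mp h

/-- If the scheme has weak stage order at least `q ≥ 2`, then there is a unique
monic polynomial `P` of minimal degree with `P(A)·τ^(k) = 0` for `k = 2,…,q`; moreover
`deg P ≤ dim K_q` and `P·Q` divides the characteristic polynomial of `A`, where `Q` is the
unique monic polynomial of minimal degree with `bᵀ Q(A) = 0`. -/
theorem exists_unique_P {s : ℕ} (A : Matrix (Fin s) (Fin s) ℝ) (b : Fin s → ℝ)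
    (q : ℕ) (hq : 2 ≤ q) (hwso : WSO A b q) :
    (∃! P : Polynomial ℝ, PProp A q P) ∧
      ∀ P Q : Polynomial ℝ, PProp A q P → QProp A b Q →
        P.natDegree ≤ Module.finrank ℝ (Kspace A q) ∧ P * Q ∣ A.charpoly := by
  have hK := charpoly_restrict_mem_residualAnnihilator A q
  refine ⟨Ideal.existsUnique_monic_degree_le (I := residualAnnihilator A q)
    ⟨_, LinearMap.charpoly_monic _, hK⟩, ?_⟩
  rintro P Q ⟨hP, hPτ, hPmin⟩ ⟨hQ, hQb, hQmin⟩
  have hPdvd := Ideal.dvd_of_monic_of_degree_le (I := residualAnnihilator A q) hP hPτ hPmin hK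
  have hQdvd := Ideal.dvd_of_monic_of_degree_le (I := weightAnnihilator A b) hQ hQb hQmin
    (charpoly_mapQ_mem_weightAnnihilator A b q hwso)
  constructor
  · refine (natDegree_le_of_dvd hPdvd (LinearMap.charpoly_monic _).ne_zero).trans_eq ?_
    exact LinearMap.charpoly_natDegree _
  · rw [← charpoly_mulVecLin, LinearMap.charpoly_eq_charpoly_restrict_mul_charpoly_mapQ
      (Kspace A q) _ (Kspace_le_comap_mulVecLin A q)]
    exact mul_dvd_mul hPdvd hQdvd

end
end

section
/- Suppose A is lower triangular (a diagonally implicit, DIRK, scheme) and the scheme satisfies the tall-tree order conditions bᵀ Aʲ e = 1/(j+1)! for 0 ≤ j ≤ p−1 (equivalently, its stability function satisfies R(z) = e^z + O(z^{p+1}) as z → 0), where p ≥ 1. Then p ≤ dim(Y) + 1 − σ, where σ = 1 if the scheme is stiffly accurate and A is invertible, and σ = 0 otherwise. -/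
open Matrix Polynomial

noncomputable section

section RealRooted

/-- The Laguerre inequality for products of real linear factors. -/
theorem laguerre_pos_of_multiset_prod (m : Multiset ℝ) (hm : m ≠ 0) (x : ℝ)
    (hx : ((m.map fun r => X - C r).prod).eval x ≠ 0) :
    0 < ((m.map fun r => X - C r).prod.derivative.eval x) ^ 2 -
      (m.map fun r => X - C r).prod.eval x *
        (m.map fun r => X - C r).prod.derivative.derivative.eval x := by
  induction m using Multiset.induction with
  | empty => exact absurd rfl hm
  | cons r t ih =>
    simp only [Multiset.map_cons, Multiset.prod_cons, eval_mul, eval_sub, eval_X, eval_C,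
      ne_eq, mul_eq_zero, not_or] at hx
    set T := (t.map fun r => X - C r).prod with hT
    have hnonneg : 0 ≤ (T.derivative.eval x) ^ 2 - T.eval x * T.derivative.derivative.eval x := by
      rcases eq_or_ne t 0 with rfl | ht
      · simp [hT]
      · exact (ih ht hx.2).le
    have hsq : 0 < (T.eval x) ^ 2 := by have := hx.2; positivity
    have hprod := mul_nonneg (sq_nonneg (x - r)) hnonneg
    simp only [Multiset.map_cons, Multiset.prod_cons, ← hT, derivative_mul, derivative_sub,
      derivative_X, derivative_C, derivative_add, eval_mul, eval_add, eval_sub, eval_X, eval_C,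
      sub_zero, one_mul]
    linarith

/-- A real-rooted polynomial with `P'(x) = -P(x)` and `P''(x) = P(x)` vanishes at `x`. -/
theorem Polynomial.Splits.eval_eq_zero_of_derivatives {P : ℝ[X]} (hP : P.Splits) {x : ℝ}
    (h₁ : P.derivative.eval x = -P.eval x) (h₂ : P.derivative.derivative.eval x = P.eval x) :
    P.eval x = 0 := by
  obtain ⟨m, hm⟩ := splits_iff_exists_multiset.1 hP
  by_contra hx
  rcases eq_or_ne m 0 with rfl | hm0
  · rw [Multiset.map_zero, Multiset.prod_zero, mul_one] at hm
    rw [hm] at h₁ hx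
    simp at h₁ hx
    exact hx h₁
  · generalize P.leadingCoeff = a at hm
    subst hm
    simp only [derivative_C_mul, eval_C_mul] at h₁ h₂ hx
    have ha : a ≠ 0 := left_ne_zero_of_mul hx
    have hpos := laguerre_pos_of_multiset_prod m hm0 x (right_ne_zero_of_mul hx)
    rw [← mul_neg] at h₁
    rw [mul_left_cancel₀ ha h₁, mul_left_cancel₀ ha h₂] at hpos
    linarith [neg_sq ((m.map fun r => X - C r).prod.eval x),
      sq ((m.map fun r => X - C r).prod.eval x)]

theorem im_sum_one_div_sub_ofReal (m : Multiset ℝ) (z : ℂ) :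
    ((m.map fun r : ℝ => 1 / (z - r)).sum).im =
      -z.im * (m.map fun r : ℝ => (Complex.normSq (z - r))⁻¹).sum := by
  induction m using Multiset.induction with
  | empty => simp
  | cons r t ih =>
    simp only [Multiset.map_cons, Multiset.sum_cons, Complex.add_im, ih]
    rw [one_div, Complex.inv_im, Complex.sub_im, Complex.ofReal_im, sub_zero]
    ring

/-- A special case of the Hermite–Poulain theorem. -/
theorem Polynomial.Splits.add_derivative {P : ℝ[X]} (hP : P.Splits) :
    (P + P.derivative).Splits := by
  rcases eq_or_ne P 0 with rfl | hP0
  · simp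
  refine Splits.of_splits_map Complex.ofRealHom (IsAlgClosed.splits _) fun z hz => ?_
  have hroot : (P.map Complex.ofRealHom).eval z +
      (P.map Complex.ofRealHom).derivative.eval z = 0 := by
    have := isRoot_of_mem_roots hz
    simpa [IsRoot, Polynomial.map_add, derivative_map] using this
  by_cases hz0 : (P.map Complex.ofRealHom).eval z = 0
  · exact hP.mem_range_of_isRoot hP0 hz0
  rw [(hP.map _).eval_derivative_eq_eval_mul_sum hz0, hP.roots_map, Multiset.map_map] at hroot
  have hsum : (P.roots.map fun r : ℝ => 1 / (z - r)).sum = -1 := by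
    refine mul_left_cancel₀ hz0 ?_
    have := eq_neg_of_add_eq_zero_right hroot
    simpa [Function.comp_def] using this
  have him := im_sum_one_div_sub_ofReal P.roots z
  rw [hsum] at him
  have hzim : z.im = 0 := by
    by_contra hne
    have hpos : ∀ r ∈ P.roots, 0 < (Complex.normSq (z - r))⁻¹ := fun r _ =>
      inv_pos.2 (Complex.normSq_pos.2 fun h => hne (by
        rw [sub_eq_zero.1 h, Complex.ofReal_im]))
    have hzero : (P.roots.map fun r : ℝ => (Complex.normSq (z - r))⁻¹).sum = 0 := by
      simpa [hne] using him
    rcases Multiset.empty_or_exists_mem P.roots with h | ⟨r, hr⟩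
    · simp [h] at hsum
    · have hle := Multiset.single_le_sum (s := P.roots.map fun r : ℝ =>
        (Complex.normSq (z - r))⁻¹) (by
          intro y hy
          obtain ⟨r, hr, rfl⟩ := Multiset.mem_map.1 hy
          exact (hpos r hr).le) _ (Multiset.mem_map_of_mem _ hr)
      linarith [hpos r hr]
  exact ⟨z.re, Complex.ext (by simp) (by simp [hzim])⟩

/-- The operator `P ↦ P + P'`, which is differentiation of `eˣ P(x)` with the factor `eˣ`
removed. -/
def addDerivative : Module.End ℝ ℝ[X] := 1 + derivative

theorem addDerivative_apply (P : ℝ[X]) : addDerivative P = P + P.derivative := by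
  simp [addDerivative]

theorem splits_addDerivative_pow {P : ℝ[X]} (hP : P.Splits) (k : ℕ) :
    ((addDerivative ^ k) P).Splits := by
  induction k with
  | zero => simpa
  | succ k ih =>
    rw [pow_succ', Module.End.mul_apply, addDerivative_apply]
    exact ih.add_derivative

/-- If two consecutive derivatives of `eˣ P(x)` vanish at a point, with `P` real-rooted, then
so does `P`. -/
theorem eval_eq_zero_of_addDerivative_pow {P : ℝ[X]} (hP : P.Splits) (x : ℝ) (k : ℕ)
    (h₀ : ((addDerivative ^ k) P).eval x = 0)
    (h₁ : ((addDerivative ^ (k + 1)) P).eval x = 0) : P.eval x = 0 := by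
  induction k with
  | zero => simpa using h₀
  | succ k ih =>
    refine ih ?_ h₀
    have hR := splits_addDerivative_pow hP k
    rw [pow_succ', pow_succ', Module.End.mul_apply, Module.End.mul_apply] at h₁
    rw [pow_succ', Module.End.mul_apply] at h₀
    simp only [addDerivative_apply, derivative_add, eval_add] at h₀ h₁
    exact hR.eval_eq_zero_of_derivatives (by linarith) (by linarith)

theorem eval_zero_addDerivative_pow (P : ℝ[X]) (k : ℕ) :
    ((addDerivative ^ k) P).eval 0 =
      ∑ j ∈ Finset.range (k + 1), (k.descFactorial j : ℝ) * P.coeff j := by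
  have h : addDerivative ^ k = ∑ j ∈ Finset.range (k + 1),
      (k.choose j : Module.End ℝ ℝ[X]) * derivative ^ j := by
    rw [addDerivative, add_comm, (Commute.one_right _).add_pow]
    refine Finset.sum_congr rfl fun j _ => ?_
    rw [one_pow, mul_one, Nat.cast_comm]
  rw [h, LinearMap.sum_apply, eval_finsetSum]
  refine Finset.sum_congr rfl fun j _ => ?_
  rw [Module.End.mul_apply, Module.End.natCast_apply, Module.End.pow_apply, eval_smul,
    ← coeff_zero_eq_eval_zero, coeff_iterate_derivative, zero_add, Nat.descFactorial_self,
    Nat.descFactorial_eq_factorial_mul_choose]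
  simp only [nsmul_eq_mul]
  push_cast
  ring

theorem Polynomial.Splits.reverse {P : ℝ[X]} (hP : P.Splits) : P.reverse.Splits := by
  obtain ⟨m, hm⟩ := splits_iff_exists_multiset.1 hP
  rw [hm, reverse_mul_of_domain, reverse_C]
  refine Splits.C_mul ?_ _
  clear hm
  induction m using Multiset.induction with
  | empty => exact (reverse_C (1 : ℝ)).symm ▸ Splits.C 1
  | cons r t ih =>
    rw [Multiset.map_cons, Multiset.prod_cons, reverse_mul_of_domain]
    refine Splits.mul (Splits.of_natDegree_le_one ?_) ih
    exact (reverse_natDegree_le _).trans (natDegree_X_sub_C_le r)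

theorem eval_zero_addDerivative_pow_reverse (Q : ℝ[X]) (n : ℕ) :
    ((addDerivative ^ (Q.natDegree + n)) Q.reverse).eval 0 =
      (Q.natDegree + n).factorial *
        ∑ i ∈ Finset.range (Q.natDegree + 1), Q.coeff i * (1 / ((n + i).factorial : ℝ)) := by
  rw [eval_zero_addDerivative_pow, Finset.mul_sum,
    ← Finset.sum_subset (Finset.range_mono (by omega : Q.natDegree + 1 ≤ Q.natDegree + n + 1)),
    ← Finset.sum_range_reflect]
  · refine Finset.sum_congr rfl fun i hi => ?_
    have hi : i ≤ Q.natDegree := Nat.lt_succ_iff.1 (Finset.mem_range.1 hi)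
    have hfac := Nat.factorial_mul_descFactorial
      (by omega : Q.natDegree - i ≤ Q.natDegree + n)
    rw [show Q.natDegree + n - (Q.natDegree - i) = n + i by omega] at hfac
    rw [Nat.add_sub_cancel, coeff_reverse, revAt_le (Nat.sub_le _ _), Nat.sub_sub_self hi, ← hfac]
    have : ((n + i).factorial : ℝ) ≠ 0 := Nat.cast_ne_zero.2 (Nat.factorial_ne_zero _)
    push_cast
    field_simp
  · intro j _ hj
    rw [coeff_eq_zero_of_natDegree_lt, mul_zero]
    have := reverse_natDegree_le Q
    have := Finset.mem_range.not.1 hj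
    omega

/-- For monic real-rooted `Q`, two consecutive Taylor coefficients of `eˣ Q*(x)`, with `Q*` the
reversed polynomial, of index at least `deg Q` cannot both vanish. -/
theorem not_consecutive_sums_eq_zero {Q : ℝ[X]} (hQ : Q.Splits) (hmonic : Q.Monic) (n : ℕ)
    (h₀ : ∑ i ∈ Finset.range (Q.natDegree + 1),
      Q.coeff i * (1 / ((n + i).factorial : ℝ)) = 0)
    (h₁ : ∑ i ∈ Finset.range (Q.natDegree + 1),
      Q.coeff i * (1 / ((n + 1 + i).factorial : ℝ)) = 0) : False := by
  have h := eval_eq_zero_of_addDerivative_pow hQ.reverse 0 (Q.natDegree + n)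
    (by rw [eval_zero_addDerivative_pow_reverse, h₀, mul_zero])
    (by rw [add_assoc, eval_zero_addDerivative_pow_reverse, h₁, mul_zero])
  rw [← coeff_zero_eq_eval_zero, coeff_zero_reverse, hmonic.leadingCoeff] at h
  exact one_ne_zero h

end RealRooted

section Annihilator

variable {s : ℕ}

theorem LowerTriangular.splits_charpoly {A : Matrix (Fin s) (Fin s) ℝ} (hA : LowerTriangular A) :
    A.charpoly.Splits := by
  rw [← charpoly_transpose, charpoly_of_isUpperTriangular Aᵀ fun i j hij => hA j i hij]
  exact Splits.prod fun i _ => Splits.X_sub_C _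

theorem vecMul_aeval_eq_sum (A : Matrix (Fin s) (Fin s) ℝ) (b : Fin s → ℝ) (Q : ℝ[X]) :
    b ᵥ* aeval A Q = ∑ i ∈ Finset.range (Q.natDegree + 1), Q.coeff i • (b ᵥ* A ^ i) := by
  rw [aeval_eq_sum_range, vecMul_sum]
  exact Finset.sum_congr rfl fun i _ => vecMul_smul _ _ _

theorem vecMul_pow_mem_Yspace (A : Matrix (Fin s) (Fin s) ℝ) (b : Fin s → ℝ) {i : ℕ}
    (hi : i < s) : b ᵥ* A ^ i ∈ Yspace A b :=
  Submodule.subset_span ⟨i, hi, by rw [← transpose_pow, mulVec_transpose]⟩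

/-- The left annihilator of `b` contains a monic divisor of the characteristic polynomial of
degree at most `dim Y`. -/
theorem exists_annihilator (A : Matrix (Fin s) (Fin s) ℝ) (b : Fin s → ℝ) :
    ∃ Q : ℝ[X], Q.Monic ∧ Q ∣ A.charpoly ∧ b ᵥ* aeval A Q = 0 ∧
      Q.natDegree ≤ Module.finrank ℝ (Yspace A b) := by
  let I : Ideal ℝ[X] :=
    { carrier := {P | b ᵥ* aeval A P = 0}
      add_mem' := fun {P R} hP hR => by
        simp only [Set.mem_ofPred_eq] at hP hR ⊢
        rw [map_add, vecMul_add, hP, hR, add_zero]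
      zero_mem' := by simp
      smul_mem' := fun R P hP => by
        simp only [Set.mem_ofPred_eq] at hP ⊢
        rw [smul_eq_mul, mul_comm, map_mul, ← vecMul_vecMul, hP, zero_vecMul] }
  have hchar : A.charpoly ∈ I := by
    change b ᵥ* aeval A A.charpoly = 0
    rw [aeval_self_charpoly, vecMul_zero]
  set G := Submodule.IsPrincipal.generator I
  have hdvd : ∀ P, P ∈ I ↔ G ∣ P := fun P => Submodule.IsPrincipal.mem_iff_generator_dvd I
  have hG0 : G ≠ 0 := fun h => A.charpoly_monic.ne_zero
    (zero_dvd_iff.1 (h ▸ (hdvd _).1 hchar))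
  have hassoc : Associated G (normalize G) := (normalize_associated G).symm
  have hdvd' : ∀ P, P ∈ I ↔ normalize G ∣ P := fun P => by rw [hdvd, hassoc.dvd_iff_dvd_left]
  set Q := normalize G
  have hQ : Q.Monic := monic_normalize hG0
  refine ⟨Q, hQ, (hdvd' _).1 hchar, (hdvd' Q).2 dvd_rfl, ?_⟩
  have hle : Q.natDegree ≤ s := by
    simpa using natDegree_le_of_dvd ((hdvd' _).1 hchar) A.charpoly_monic.ne_zero
  let f : degreeLT ℝ Q.natDegree →ₗ[ℝ] Fin s → ℝ :=
    (vecMulBilin ℝ ℝ b ∘ₗ (aeval A).toLinearMap) ∘ₗ (degreeLT ℝ Q.natDegree).subtype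
  have hf : ∀ P, f P = b ᵥ* aeval A (P : ℝ[X]) := fun _ => rfl
  have hfY : ∀ P, f P ∈ Yspace A b := by
    rintro ⟨P, hP⟩
    rw [hf, vecMul_aeval_eq_sum]
    refine Submodule.sum_mem _ fun i hi => ?_
    rcases eq_or_ne (P.coeff i) 0 with h | h
    · simp [h]
    · refine Submodule.smul_mem _ _ (vecMul_pow_mem_Yspace A b (lt_of_lt_of_le ?_ hle))
      by_contra hlt
      exact h (coeff_eq_zero_of_degree_lt
        ((mem_degreeLT.1 hP).trans_le (by exact_mod_cast not_lt.1 hlt)))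
  have hinj : Function.Injective (f.codRestrict (Yspace A b) hfY) := by
    refine (injective_iff_map_eq_zero _).2 fun P hP => ?_
    have hPI : (P : ℝ[X]) ∈ I := congrArg Subtype.val hP
    refine Subtype.ext (eq_zero_of_dvd_of_degree_lt ((hdvd' _).1 hPI) ?_)
    rw [degree_eq_natDegree hQ.ne_zero]
    exact mem_degreeLT.1 P.2
  have hfin := LinearMap.finrank_le_finrank_of_injective hinj
  rwa [(degreeLTEquiv ℝ Q.natDegree).finrank_eq, Module.finrank_fin_fun] at hfin

end Annihilator

/-- For a DIRK scheme (`A` lower triangular) with `bᵀ Aʲ e = 1/(j+1)!` for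
`0 ≤ j ≤ p−1` (`p ≥ 1`), one has `p ≤ dim(Y) + 1 − σ`, where `σ = 1` if the scheme is stiffly
accurate with `A` invertible, and `σ = 0` otherwise. -/
theorem dirk_order_bound_dim_Y {s : ℕ} (hs : 0 < s) (A : Matrix (Fin s) (Fin s) ℝ)
    (b : Fin s → ℝ) (p σ : ℕ) (hp : 1 ≤ p)
    (hdirk : LowerTriangular A)
    (horder : ∀ j : ℕ, j < p → b ⬝ᵥ (A ^ j).mulVec (ones s) = 1 / (Nat.factorial (j + 1)))
    (hσ : (σ = 1 ∧ StifflyAccurate hs A b ∧ IsUnit A.det) ∨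
          (σ = 0 ∧ ¬(StifflyAccurate hs A b ∧ IsUnit A.det))) :
    (p : ℤ) ≤ (Module.finrank ℝ (Yspace A b) : ℤ) + 1 - σ := by
  obtain ⟨Q, hQ, hdvd, hann, hdeg⟩ := exists_annihilator A b
  have hsplit : Q.Splits := hdirk.splits_charpoly.of_dvd A.charpoly_monic.ne_zero hdvd
  have hsum : ∀ v : Fin s → ℝ, ∑ i ∈ Finset.range (Q.natDegree + 1),
      Q.coeff i * (b ⬝ᵥ (A ^ i).mulVec v) = 0 := fun v => by
    have h := congrArg (· ⬝ᵥ v) (vecMul_aeval_eq_sum A b Q)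
    simpa [hann, sum_dotProduct, dotProduct_mulVec] using h.symm
  have hsum_of : ∀ (v : Fin s → ℝ) (n : ℕ),
      (∀ i ≤ Q.natDegree, b ⬝ᵥ (A ^ i).mulVec v = 1 / ((n + i).factorial : ℝ)) →
      ∑ i ∈ Finset.range (Q.natDegree + 1),
        Q.coeff i * (1 / ((n + i).factorial : ℝ)) = 0 := fun v n hv => by
    rw [← hsum v]
    exact Finset.sum_congr rfl fun i hi =>
      by rw [hv i (Nat.lt_succ_iff.1 (Finset.mem_range.1 hi))]
  have hone : Q.natDegree < p → ∑ i ∈ Finset.range (Q.natDegree + 1),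
      Q.coeff i * (1 / ((1 + i).factorial : ℝ)) = 0 := fun hlt =>
    hsum_of (ones s) 1 fun i hi => by rw [horder i (by omega), add_comm]
  by_contra hlt
  rcases hσ with ⟨rfl, hstiff, hdet⟩ | ⟨rfl, -⟩
  · have hAv : A.mulVec (A⁻¹.mulVec (ones s)) = ones s := by
      rw [mulVec_mulVec, mul_nonsing_inv A hdet, one_mulVec]
    refine not_consecutive_sums_eq_zero hsplit hQ 0
      (hsum_of (A⁻¹.mulVec (ones s)) 0 fun i hi => ?_) (hone (by omega))
    rcases i with _ | i
    · have hrow := congrFun hAv ⟨s - 1, Nat.sub_lt hs Nat.one_pos⟩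
      rw [mulVec, funext hstiff] at hrow
      simpa [ones] using hrow
    · rw [pow_succ, ← mulVec_mulVec, hAv, horder i (by omega), zero_add]
  · refine not_consecutive_sums_eq_zero hsplit hQ 1 (hone (by omega))
      (hsum_of (A.mulVec (ones s)) 2 fun i hi => ?_)
    rw [mulVec_mulVec, ← pow_succ, horder (i + 1) (by omega), add_comm 2 i]

end
end

section
/- Suppose A is lower triangular (a DIRK scheme) and the scheme is not a GEDIRK. If m ≥ 2n_c, then dim(K_m) ≥ n_c. -/
open Matrix Polynomial

noncomputable section

/-- Hermite interpolation with prescribed values and vanishing derivatives on a finite set. -/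
theorem exists_interpolate_derivative_eq_zero (f : ℝ → ℝ) (S : Finset ℝ) :
    ∃ p : ℝ[X], p.degree < (2 * S.card : ℕ) ∧
      ∀ x ∈ S, p.eval x = f x ∧ p.derivative.eval x = 0 := by
  classical
  induction S using Finset.induction_on with
  | empty => exact ⟨0, by simp⟩
  | insert a S ha ih =>
    obtain ⟨p, hp, hpS⟩ := ih
    set r : ℝ[X] := ∏ y ∈ S, (X - C y) with hr
    have hra : r.eval a ≠ 0 := by
      rw [hr, eval_prod, Finset.prod_ne_zero_iff]
      intro y hy
      simpa [sub_eq_zero] using fun h : a = y => ha (h ▸ hy)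
    have hrS : ∀ x ∈ S, r.eval x = 0 := by
      intro x hx
      rw [hr, eval_prod]
      exact Finset.prod_eq_zero hx (by simp)
    have hrdeg : r.natDegree = S.card := by
      rw [hr, natDegree_prod_of_monic _ _ fun y _ => monic_X_sub_C y]
      simp
    set α : ℝ := (f a - p.eval a) / r.eval a ^ 2 with hα
    set β : ℝ := -(p.derivative.eval a + α * (2 * r.eval a * r.derivative.eval a))
      / r.eval a ^ 2 with hβ
    refine ⟨p + (C α + C β * (X - C a)) * r ^ 2, ?_, ?_⟩
    · rw [Finset.card_insert_of_notMem ha]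
      refine (degree_add_le _ _).trans_lt (max_lt (hp.trans ?_) ?_)
      · exact_mod_cast (by omega : 2 * S.card < 2 * (S.card + 1))
      · refine degree_le_natDegree.trans_lt ?_
        have h1 : (C α + C β * (X - C a)).natDegree ≤ 1 := by compute_degree
        have h2 : (r ^ 2).natDegree ≤ 2 * S.card := by
          simp [hrdeg]
        have h3 := natDegree_mul_le (p := C α + C β * (X - C a)) (q := r ^ 2)
        exact_mod_cast (by omega :
          ((C α + C β * (X - C a)) * r ^ 2).natDegree < 2 * (S.card + 1))
    · intro x hx
      rcases Finset.mem_insert.1 hx with rfl | hx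
      · simp only [eval_add, eval_mul, eval_C, eval_sub, eval_X, eval_pow, derivative_add,
          derivative_mul, derivative_C, derivative_X, derivative_pow, derivative_sub]
        constructor
        · rw [hα]; field_simp; simp
        · simp
          rw [hβ]; field_simp; ring
      · simp [hrS x hx, hpS x hx, derivative_pow]

/-- Hermite interpolation with vanishing derivatives and a prescribed zero at the origin. -/
theorem exists_interpolate_derivative_eq_zero_of_zero (f : ℝ → ℝ) (hf : f 0 = 0)
    (S : Finset ℝ) :
    ∃ p : ℝ[X], p.natDegree ≤ 2 * S.card ∧ p.eval 0 = 0 ∧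
      ∀ x ∈ S, p.eval x = f x ∧ p.derivative.eval x = 0 := by
  obtain ⟨p, hp, hpS⟩ := exists_interpolate_derivative_eq_zero f S
  have hp' : p.natDegree ≤ 2 * S.card := natDegree_le_of_degree_le hp.le
  by_cases h0 : (0 : ℝ) ∈ S
  · exact ⟨p, hp', (hpS 0 h0).1.trans hf, hpS⟩
  set r : ℝ[X] := ∏ y ∈ S, (X - C y) with hr
  have hr0 : r.eval 0 ≠ 0 := by
    rw [hr, eval_prod, Finset.prod_ne_zero_iff]
    intro y hy
    simpa using fun h : y = 0 => h0 (h ▸ hy)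
  have hrS : ∀ x ∈ S, r.eval x = 0 := by
    intro x hx
    rw [hr, eval_prod]
    exact Finset.prod_eq_zero hx (by simp)
  have hrdeg : r.natDegree = S.card := by
    rw [hr, natDegree_prod_of_monic _ _ fun y _ => monic_X_sub_C y]
    simp
  refine ⟨p - C (p.eval 0 / r.eval 0 ^ 2) * r ^ 2, ?_, ?_, ?_⟩
  · refine (natDegree_sub_le _ _).trans (max_le hp' ((natDegree_C_mul_le _ _).trans ?_))
    simp [hrdeg]
  · simp only [eval_sub, eval_mul, eval_C, eval_pow]
    field_simp
    simp
  · intro x hx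
    simp [hrS x hx, hpS x hx, derivative_pow]

/-- The residual `A p'(c) - p(c)` as a linear function of the polynomial `p`. -/
def residualMap {s : ℕ} (A : Matrix (Fin s) (Fin s) ℝ) : ℝ[X] →ₗ[ℝ] (Fin s → ℝ) :=
  A.mulVecLin ∘ₗ (LinearMap.pi fun i => leval (cvec A i)) ∘ₗ derivative -
    LinearMap.pi fun i => leval (cvec A i)

theorem residualMap_monomial {s : ℕ} (A : Matrix (Fin s) (Fin s) ℝ) (k : ℕ) (hk : 1 ≤ k)
    (a : ℝ) : residualMap A (monomial k a) = (a * k) • tauvec A k := by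
  have hk0 : (k : ℝ) ≠ 0 := by positivity
  have h : (fun i => (derivative (monomial k a)).eval (cvec A i)) =
      (a * k) • fun i => cvec A i ^ (k - 1) := by
    ext i
    simp [derivative_monomial]
  have h' : residualMap A (monomial k a) =
      A *ᵥ (fun i => (derivative (monomial k a)).eval (cvec A i)) -
        fun i => (monomial k a).eval (cvec A i) := rfl
  rw [h', h, mulVec_smul, tauvec, smul_sub]
  congr 1
  ext i
  simp
  field_simp

/-- Linear combinations of the residuals, multiplied by `A ^ j`, lie in `Kspace A m`. -/
theorem pow_mulVec_residualMap_mem_Kspace {s : ℕ} (A : Matrix (Fin s) (Fin s) ℝ) {m j : ℕ}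
    (hj : j < s) (p : ℝ[X]) (hp : p.natDegree ≤ m) (h0 : p.eval 0 = 0) :
    (A ^ j) *ᵥ residualMap A p ∈ Kspace A m := by
  rw [p.as_sum_range, map_sum, mulVec_sum]
  refine Submodule.sum_mem _ fun k hk => ?_
  rcases Nat.eq_zero_or_pos k with rfl | hk0
  · rw [← coeff_zero_eq_eval_zero] at h0
    simp [h0]
  · rw [residualMap_monomial A k hk0, mulVec_smul]
    refine Submodule.smul_mem _ _ (Submodule.subset_span ⟨j, k, hj, hk0, ?_, rfl⟩)
    have := Finset.mem_range.1 hk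
    omega

/-- Functions of the abscissas vanishing at zero lie in `Kspace A m`, as do their images under
powers of `A`. -/
theorem pow_mulVec_comp_cvec_mem_Kspace {s : ℕ} (A : Matrix (Fin s) (Fin s) ℝ) {m j : ℕ}
    (hm : 2 * numAbscissas A ≤ m) (hj : j < s) (f : ℝ → ℝ) (hf : f 0 = 0) :
    (A ^ j) *ᵥ (fun i => f (cvec A i)) ∈ Kspace A m := by
  obtain ⟨p, hp, hp0, hpS⟩ :=
    exists_interpolate_derivative_eq_zero_of_zero f hf (Finset.univ.image (cvec A))
  have hS : ∀ i, cvec A i ∈ Finset.univ.image (cvec A) := fun i =>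
    Finset.mem_image_of_mem _ (Finset.mem_univ i)
  have h := pow_mulVec_residualMap_mem_Kspace A hj p (hp.trans hm) hp0
  have h1 : residualMap A p = A *ᵥ (fun i => p.derivative.eval (cvec A i)) -
      fun i => p.eval (cvec A i) := rfl
  have h2 : (fun i => p.derivative.eval (cvec A i)) = 0 := funext fun i => (hpS _ (hS i)).2
  have h3 : (fun i => p.eval (cvec A i)) = fun i => f (cvec A i) :=
    funext fun i => (hpS _ (hS i)).1
  rw [h1, h2, h3, mulVec_zero, zero_sub, mulVec_neg] at h
  exact neg_mem_iff.1 h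

/-- If `c` has a zero entry and the scheme is a DIRK but not a GEDIRK, some vector of
`Kspace A m` is nonzero at an index where `c` vanishes. -/
theorem exists_mem_Kspace_ne_zero {s : ℕ} (A : Matrix (Fin s) (Fin s) ℝ) {m : ℕ}
    (hdirk : LowerTriangular A) (hged : ¬ GEDIRK A) (hm : 2 * numAbscissas A ≤ m)
    (hzero : ∃ i, cvec A i = 0) :
    ∃ l, cvec A l = 0 ∧ ∃ w ∈ Kspace A m, w l ≠ 0 := by
  classical
  obtain ⟨l, hl, hmin⟩ : ∃ l, cvec A l = 0 ∧ ∀ j < l, cvec A j ≠ 0 := by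
    obtain ⟨l, hl, hmin⟩ := wellFounded_lt.has_min {i : Fin s | cvec A i = 0} hzero
    exact ⟨l, hl, fun j hj h => hmin j h hj⟩
  have hll : A l l ≠ 0 := fun h => hged ⟨l, hl, hmin, h⟩
  set v : Fin s → ℝ := fun i => if cvec A i = 0 then 0 else 1 with hv
  have hAv : (A *ᵥ v) l = -A l l := by
    have hdiff : (A *ᵥ v) l - cvec A l = -A l l := by
      simp only [cvec, mulVec, dotProduct, ← Finset.sum_sub_distrib]
      rw [Finset.sum_eq_single l]
      · simp [hv, hl, ones]
      · intro j _ hj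
        rcases lt_or_gt_of_ne hj with hj | hj
        · simp [hv, hmin j hj, ones]
        · simp [hdirk l j hj]
      · simp
    simpa [hl] using hdiff
  have hs : 1 < s := by
    by_contra hs
    have hsub : ∀ j, j = l := fun j => Fin.ext (by omega)
    have hv0 : v = 0 := funext fun j => by simp [hv, hsub j, hl]
    rw [hv0, mulVec_zero] at hAv
    exact hll (neg_eq_zero.1 hAv.symm)
  refine ⟨l, hl, A *ᵥ v, ?_, by rwa [hAv, neg_ne_zero]⟩
  simpa using pow_mulVec_comp_cvec_mem_Kspace A hm hs
    (fun x => if x = 0 then 0 else 1) (by simp)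

/-- For a DIRK scheme that is not a GEDIRK, if `m ≥ 2n_c` then
`dim(K_m) ≥ n_c`. -/
theorem dirk_dim_K_ge_nc {s : ℕ} (A : Matrix (Fin s) (Fin s) ℝ) (m : ℕ)
    (hdirk : LowerTriangular A) (hged : ¬ GEDIRK A) (hm : 2 * numAbscissas A ≤ m) :
    numAbscissas A ≤ Module.finrank ℝ (Kspace A m) := by
  classical
  set S := Finset.univ.image (cvec A) with hS
  obtain ⟨w, hw, hwl⟩ : ∃ w ∈ Kspace A m,
      (∃ i, cvec A i = 0) → ∃ l, cvec A l = 0 ∧ w l ≠ 0 := by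
    by_cases hzero : ∃ i, cvec A i = 0
    · obtain ⟨l, hl, w, hw, hwl⟩ := exists_mem_Kspace_ne_zero A hdirk hged hm hzero
      exact ⟨w, hw, fun _ => ⟨l, hl, hwl⟩⟩
    · exact ⟨0, zero_mem _, fun h => absurd h hzero⟩
  let ext0 : (S → ℝ) → ℝ → ℝ := fun g x => if h : x ∈ S then g ⟨x, h⟩ else 0
  let Φ : (S → ℝ) →ₗ[ℝ] (Fin s → ℝ) :=
    { toFun := fun g i => (if cvec A i = 0 then 0 else ext0 g (cvec A i)) + ext0 g 0 * w i
      map_add' := by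
        intro g h
        ext i
        simp only [ext0, Pi.add_apply]
        split_ifs <;> ring
      map_smul' := by
        intro a g
        ext i
        simp only [ext0, Pi.smul_apply, smul_eq_mul, RingHom.id_apply]
        split_ifs <;> ring }
  have hΦmem : ∀ g, Φ g ∈ Kspace A m := by
    intro g
    rcases Nat.eq_zero_or_pos s with rfl | hs
    · rw [Subsingleton.elim (Φ g) 0]
      exact zero_mem _
    have h := pow_mulVec_comp_cvec_mem_Kspace A hm hs
      (fun x => if x = 0 then 0 else ext0 g x) (by simp)
    rw [pow_zero, one_mulVec] at h
    exact add_mem h (Submodule.smul_mem _ (ext0 g 0) hw)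
  have hΦinj : Function.Injective (Φ.codRestrict (Kspace A m) hΦmem) := by
    rw [injective_iff_map_eq_zero]
    intro g hg
    have hi : ∀ i, (if cvec A i = 0 then 0 else ext0 g (cvec A i)) + ext0 g 0 * w i = 0 :=
      fun i => congrFun (congrArg Subtype.val hg) i
    have hg0 : ext0 g 0 = 0 := by
      by_cases hzero : ∃ i, cvec A i = 0
      · obtain ⟨l, hl, hwl⟩ := hwl hzero
        simpa [hl, hwl] using hi l
      · have : (0 : ℝ) ∉ S := by simpa [hS] using hzero
        simp [ext0, this]
    ext ⟨x, hx⟩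
    have hgx : ext0 g x = g ⟨x, hx⟩ := dif_pos hx
    obtain ⟨i, -, rfl⟩ := Finset.mem_image.1 hx
    refine hgx.symm.trans ?_
    by_cases hci : cvec A i = 0
    · exact (congrArg (ext0 g) hci).trans hg0
    · simpa [hci, hg0] using hi i
  simpa [numAbscissas] using LinearMap.finrank_le_finrank_of_injective hΦinj

end
end
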